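/- (Lemma 3) Let W, W' ∈ ℕ^{L_2} be window-size vectors with W'_j ≤ W_j for every j ∈ {0,…,L_2−1}, and let δ ∈ [0,1]. Define the worst-case window BP threshold ε^{worst}_{δ,W} = sSup of the set {ε ∈ [0,1] : the sequence l ↦ q^{(l)}_{W,(0,0)}(ε) converges to some a with a ≤ δ}, where q^{(l)}_W(ε) is the worst-case window constellation for window-size vector W and channel parameter ε. Then ε^{worst}_{δ,W'} ≤ ε^{worst}_{δ,W}. -/

import Mathlib

/-- Check-node DE map `Y(z)` for the MD-SC ensemble. -/
noncomputable def chkY (L₂ dr γ₁ γ₂ : ℕ) (T : ℝ) (z : ℤ × ZMod L₂ → ℝ)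
    (p : ℤ × ZMod L₂) : ℝ :=
  1 - (1 - ((1 - T) / (γ₁ : ℝ)) * ∑ k ∈ Finset.range γ₁, z (p.1 - (k : ℤ), p.2)
        - (T / ((γ₁ : ℝ) * ((γ₂ : ℝ) - 1))) *
            ∑ k ∈ Finset.range γ₁, ∑ r ∈ Finset.Icc 1 (γ₂ - 1),
              z (p.1 - (k : ℤ), p.2 - (r : ZMod L₂))) ^ (dr - 1)

/-- One-step DE update `F(z)` for the MD-SC ensemble. -/
noncomputable def updF (L₂ dl dr γ₁ γ₂ : ℕ) (T ε : ℝ) (z : ℤ × ZMod L₂ → ℝ)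
    (p : ℤ × ZMod L₂) : ℝ :=
  ε * (((1 - T) / (γ₁ : ℝ)) *
          ∑ k ∈ Finset.range γ₁, chkY L₂ dr γ₁ γ₂ T z (p.1 + (k : ℤ), p.2)
        + (T / ((γ₁ : ℝ) * ((γ₂ : ℝ) - 1))) *
            ∑ k ∈ Finset.range γ₁, ∑ r ∈ Finset.Icc 1 (γ₂ - 1),
              chkY L₂ dr γ₁ γ₂ T z (p.1 + (k : ℤ), p.2 + (r : ZMod L₂))) ^ (dl - 1)
open Classical in
/-- The windowed DE update with window `S`. -/
noncomputable def winUpd (L₂ dl dr γ₁ γ₂ : ℕ) (T ε : ℝ) (S : Set (ℤ × ZMod L₂))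
    (z : ℤ × ZMod L₂ → ℝ) (p : ℤ × ZMod L₂) : ℝ :=
  if p ∈ S then updF L₂ dl dr γ₁ γ₂ T ε z p else z p

/-- Iterates of the windowed DE update starting from `z₀`. -/
noncomputable def winIter (L₂ dl dr γ₁ γ₂ : ℕ) (T ε : ℝ) (S : Set (ℤ × ZMod L₂))
    (z₀ : ℤ × ZMod L₂ → ℝ) : ℕ → ℤ × ZMod L₂ → ℝ
  | 0 => z₀
  | l + 1 => winUpd L₂ dl dr γ₁ γ₂ T ε S (winIter L₂ dl dr γ₁ γ₂ T ε S z₀ l)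
/-- The window configuration `S^W_{(i_t,j_t)}` for window-size vector `W` and target
section `(i_t, j_t)`. -/
def winConfig (L₂ : ℕ) (W : ZMod L₂ → ℕ) (t : ℤ × ZMod L₂) : Set (ℤ × ZMod L₂) :=
  {p | ∃ r : ℕ, r < L₂ ∧ ∃ k : ℕ, k < W (t.2 + (r : ZMod L₂)) ∧
        p = (t.1 + (k : ℤ), t.2 + (r : ZMod L₂))}

/-- The worst-case initial constellation: `δ` for `i < 0` and `1` for `i ≥ 0`. -/
noncomputable def worstInit (L₂ : ℕ) (δ : ℝ) : ℤ × ZMod L₂ → ℝ :=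
  fun p => if p.1 < 0 then δ else 1

/-- The worst-case window constellation `q^[l]` for window-size vector `W`. -/
noncomputable def worstQ (L₂ dl dr γ₁ γ₂ : ℕ) (T ε δ : ℝ) (W : ZMod L₂ → ℕ) :
    ℕ → ℤ × ZMod L₂ → ℝ :=
  winIter L₂ dl dr γ₁ γ₂ T ε (winConfig L₂ W ((0 : ℤ), (0 : ZMod L₂))) (worstInit L₂ δ)
/-- The worst-case window BP threshold `ε^worst_{δ,W}`. -/
noncomputable def epsWorst (L₂ dl dr γ₁ γ₂ : ℕ) (T δ : ℝ) (W : ZMod L₂ → ℕ) : ℝ :=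
  sSup {ε : ℝ | ε ∈ Set.Icc (0 : ℝ) 1 ∧ ∃ a : ℝ, a ≤ δ ∧
    Filter.Tendsto (fun l => worstQ L₂ dl dr γ₁ γ₂ T ε δ W l ((0 : ℤ), (0 : ZMod L₂)))
      Filter.atTop (nhds a)}

/-- The two-level weighted average underlying both the check-node and the variable-node maps. -/
noncomputable def couplingAvg (γ₁ γ₂ : ℕ) (T : ℝ) (f : ℕ → ℝ) (g : ℕ → ℕ → ℝ) : ℝ :=
  ((1 - T) / (γ₁ : ℝ)) * ∑ k ∈ Finset.range γ₁, f k
    + (T / ((γ₁ : ℝ) * ((γ₂ : ℝ) - 1))) *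
        ∑ k ∈ Finset.range γ₁, ∑ r ∈ Finset.Icc 1 (γ₂ - 1), g k r

theorem couplingAvg_mono {γ₁ γ₂ : ℕ} {T : ℝ} (hγ₂ : 2 ≤ γ₂) (hT : T ∈ Set.Icc (0 : ℝ) 1)
    {f f' : ℕ → ℝ} {g g' : ℕ → ℕ → ℝ} (hf : ∀ k, f k ≤ f' k) (hg : ∀ k r, g k r ≤ g' k r) :
    couplingAvg γ₁ γ₂ T f g ≤ couplingAvg γ₁ γ₂ T f' g' := by
  have h2 : (2 : ℝ) ≤ γ₂ := by exact_mod_cast hγ₂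
  have h1 : (0 : ℝ) ≤ γ₁ := Nat.cast_nonneg _
  have ha : 0 ≤ (1 - T) / (γ₁ : ℝ) := div_nonneg (by linarith [hT.2]) h1
  have hb : 0 ≤ T / ((γ₁ : ℝ) * ((γ₂ : ℝ) - 1)) :=
    div_nonneg hT.1 (mul_nonneg h1 (by linarith))
  exact add_le_add
    (mul_le_mul_of_nonneg_left (Finset.sum_le_sum fun k _ => hf k) ha)
    (mul_le_mul_of_nonneg_left
      (Finset.sum_le_sum fun k _ => Finset.sum_le_sum fun r _ => hg k r) hb)

theorem couplingAvg_const {γ₁ γ₂ : ℕ} (T : ℝ) (hγ₁ : 1 ≤ γ₁) (hγ₂ : 2 ≤ γ₂) (c : ℝ) :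
    couplingAvg γ₁ γ₂ T (fun _ => c) (fun _ _ => c) = c := by
  have h2 : (2 : ℝ) ≤ γ₂ := by exact_mod_cast hγ₂
  have h1 : (γ₁ : ℝ) ≠ 0 := by positivity
  have h3 : (γ₂ : ℝ) - 1 ≠ 0 := by linarith
  have hc : ((γ₂ - 1 : ℕ) : ℝ) = (γ₂ : ℝ) - 1 := by
    rw [Nat.cast_sub (by omega), Nat.cast_one]
  simp only [couplingAvg, Finset.sum_const, Finset.card_range, Nat.card_Icc, nsmul_eq_mul,
    Nat.add_sub_cancel, hc]
  field_simp
  ring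

theorem couplingAvg_mem_Icc {γ₁ γ₂ : ℕ} {T : ℝ} (hγ₁ : 1 ≤ γ₁) (hγ₂ : 2 ≤ γ₂)
    (hT : T ∈ Set.Icc (0 : ℝ) 1) {f : ℕ → ℝ} {g : ℕ → ℕ → ℝ}
    (hf : ∀ k, f k ∈ Set.Icc (0 : ℝ) 1) (hg : ∀ k r, g k r ∈ Set.Icc (0 : ℝ) 1) :
    couplingAvg γ₁ γ₂ T f g ∈ Set.Icc (0 : ℝ) 1 := by
  constructor
  · rw [← couplingAvg_const T hγ₁ hγ₂ 0]
    exact couplingAvg_mono hγ₂ hT (fun k => (hf k).1) (fun k r => (hg k r).1)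
  · rw [← couplingAvg_const T hγ₁ hγ₂ 1]
    exact couplingAvg_mono hγ₂ hT (fun k => (hf k).2) (fun k r => (hg k r).2)

theorem chkY_eq_couplingAvg (L₂ dr γ₁ γ₂ : ℕ) (T : ℝ) (z : ℤ × ZMod L₂ → ℝ)
    (p : ℤ × ZMod L₂) :
    chkY L₂ dr γ₁ γ₂ T z p = 1 - (1 - couplingAvg γ₁ γ₂ T (fun k => z (p.1 - (k : ℤ), p.2))
      (fun k r => z (p.1 - (k : ℤ), p.2 - (r : ZMod L₂)))) ^ (dr - 1) := by
  simp only [chkY, couplingAvg, sub_sub]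

theorem updF_eq_couplingAvg (L₂ dl dr γ₁ γ₂ : ℕ) (T ε : ℝ) (z : ℤ × ZMod L₂ → ℝ)
    (p : ℤ × ZMod L₂) :
    updF L₂ dl dr γ₁ γ₂ T ε z p =
      ε * couplingAvg γ₁ γ₂ T (fun k => chkY L₂ dr γ₁ γ₂ T z (p.1 + (k : ℤ), p.2))
        (fun k r => chkY L₂ dr γ₁ γ₂ T z (p.1 + (k : ℤ), p.2 + (r : ZMod L₂))) ^ (dl - 1) :=
  rfl

theorem chkY_mem_Icc {L₂ γ₁ γ₂ : ℕ} (dr : ℕ) {T : ℝ} (hγ₁ : 1 ≤ γ₁) (hγ₂ : 2 ≤ γ₂)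
    (hT : T ∈ Set.Icc (0 : ℝ) 1) {z : ℤ × ZMod L₂ → ℝ}
    (hz : ∀ p, z p ∈ Set.Icc (0 : ℝ) 1) (p : ℤ × ZMod L₂) :
    chkY L₂ dr γ₁ γ₂ T z p ∈ Set.Icc (0 : ℝ) 1 := by
  rw [chkY_eq_couplingAvg]
  have h := couplingAvg_mem_Icc hγ₁ hγ₂ hT (fun k => hz (p.1 - (k : ℤ), p.2))
    (fun k r => hz (p.1 - (k : ℤ), p.2 - (r : ZMod L₂)))
  exact ⟨sub_nonneg.2 (pow_le_one₀ (sub_nonneg.2 h.2) (sub_le_self _ h.1)),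
    sub_le_self _ (pow_nonneg (sub_nonneg.2 h.2) _)⟩

theorem chkY_mono {L₂ γ₁ γ₂ : ℕ} (dr : ℕ) {T : ℝ} (hγ₁ : 1 ≤ γ₁) (hγ₂ : 2 ≤ γ₂)
    (hT : T ∈ Set.Icc (0 : ℝ) 1) {z z' : ℤ × ZMod L₂ → ℝ}
    (hz' : ∀ p, z' p ∈ Set.Icc (0 : ℝ) 1) (h : ∀ p, z p ≤ z' p) (p : ℤ × ZMod L₂) :
    chkY L₂ dr γ₁ γ₂ T z p ≤ chkY L₂ dr γ₁ γ₂ T z' p := by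
  rw [chkY_eq_couplingAvg, chkY_eq_couplingAvg]
  have h' := couplingAvg_mem_Icc hγ₁ hγ₂ hT (fun k => hz' (p.1 - (k : ℤ), p.2))
    (fun k r => hz' (p.1 - (k : ℤ), p.2 - (r : ZMod L₂)))
  exact sub_le_sub_left (pow_le_pow_left₀ (sub_nonneg.2 h'.2)
    (sub_le_sub_left (couplingAvg_mono hγ₂ hT (fun _ => h _) (fun _ _ => h _)) _) _) _

theorem updF_mem_Icc {L₂ γ₁ γ₂ : ℕ} (dl dr : ℕ) {T ε : ℝ} (hγ₁ : 1 ≤ γ₁) (hγ₂ : 2 ≤ γ₂)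
    (hT : T ∈ Set.Icc (0 : ℝ) 1) (hε : ε ∈ Set.Icc (0 : ℝ) 1) {z : ℤ × ZMod L₂ → ℝ}
    (hz : ∀ p, z p ∈ Set.Icc (0 : ℝ) 1) (p : ℤ × ZMod L₂) :
    updF L₂ dl dr γ₁ γ₂ T ε z p ∈ Set.Icc (0 : ℝ) 1 := by
  rw [updF_eq_couplingAvg]
  have h := couplingAvg_mem_Icc hγ₁ hγ₂ hT
    (fun k => chkY_mem_Icc dr hγ₁ hγ₂ hT hz (p.1 + (k : ℤ), p.2))
    (fun k r => chkY_mem_Icc dr hγ₁ hγ₂ hT hz (p.1 + (k : ℤ), p.2 + (r : ZMod L₂)))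
  exact ⟨mul_nonneg hε.1 (pow_nonneg h.1 _),
    mul_le_one₀ hε.2 (pow_nonneg h.1 _) (pow_le_one₀ h.1 h.2)⟩

theorem updF_mono {L₂ γ₁ γ₂ : ℕ} (dl dr : ℕ) {T ε : ℝ} (hγ₁ : 1 ≤ γ₁) (hγ₂ : 2 ≤ γ₂)
    (hT : T ∈ Set.Icc (0 : ℝ) 1) (hε : 0 ≤ ε) {z z' : ℤ × ZMod L₂ → ℝ}
    (hz : ∀ p, z p ∈ Set.Icc (0 : ℝ) 1) (hz' : ∀ p, z' p ∈ Set.Icc (0 : ℝ) 1)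
    (h : ∀ p, z p ≤ z' p) (p : ℤ × ZMod L₂) :
    updF L₂ dl dr γ₁ γ₂ T ε z p ≤ updF L₂ dl dr γ₁ γ₂ T ε z' p := by
  rw [updF_eq_couplingAvg, updF_eq_couplingAvg]
  have h0 := couplingAvg_mem_Icc hγ₁ hγ₂ hT
    (fun k => chkY_mem_Icc dr hγ₁ hγ₂ hT hz (p.1 + (k : ℤ), p.2))
    (fun k r => chkY_mem_Icc dr hγ₁ hγ₂ hT hz (p.1 + (k : ℤ), p.2 + (r : ZMod L₂)))
  exact mul_le_mul_of_nonneg_left (pow_le_pow_left₀ h0.1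
    (couplingAvg_mono hγ₂ hT (fun _ => chkY_mono dr hγ₁ hγ₂ hT hz' h _)
      (fun _ _ => chkY_mono dr hγ₁ hγ₂ hT hz' h _)) _) hε

theorem winIter_mem_Icc {L₂ γ₁ γ₂ : ℕ} (dl dr : ℕ) {T ε : ℝ} (hγ₁ : 1 ≤ γ₁) (hγ₂ : 2 ≤ γ₂)
    (hT : T ∈ Set.Icc (0 : ℝ) 1) (hε : ε ∈ Set.Icc (0 : ℝ) 1) (S : Set (ℤ × ZMod L₂))
    {z₀ : ℤ × ZMod L₂ → ℝ} (hz₀ : ∀ p, z₀ p ∈ Set.Icc (0 : ℝ) 1) (l : ℕ) (p : ℤ × ZMod L₂) :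
    winIter L₂ dl dr γ₁ γ₂ T ε S z₀ l p ∈ Set.Icc (0 : ℝ) 1 := by
  induction l generalizing p with
  | zero => exact hz₀ p
  | succ l ih =>
    simp only [winIter, winUpd]
    split_ifs
    · exact updF_mem_Icc dl dr hγ₁ hγ₂ hT hε ih p
    · exact ih p

theorem winIter_of_notMem {L₂ : ℕ} (dl dr γ₁ γ₂ : ℕ) (T ε : ℝ) {S : Set (ℤ × ZMod L₂)}
    (z₀ : ℤ × ZMod L₂ → ℝ) (l : ℕ) {p : ℤ × ZMod L₂} (hp : p ∉ S) :
    winIter L₂ dl dr γ₁ γ₂ T ε S z₀ l p = z₀ p := by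
  induction l with
  | zero => rfl
  | succ l ih => simpa only [winIter, winUpd, if_neg hp] using ih

/-- If the initial constellation is maximal on the window, the windowed iteration decreases. -/
theorem winIter_antitone {L₂ γ₁ γ₂ : ℕ} (dl dr : ℕ) {T ε : ℝ} (hγ₁ : 1 ≤ γ₁) (hγ₂ : 2 ≤ γ₂)
    (hT : T ∈ Set.Icc (0 : ℝ) 1) (hε : ε ∈ Set.Icc (0 : ℝ) 1) {S : Set (ℤ × ZMod L₂)}
    {z₀ : ℤ × ZMod L₂ → ℝ} (hz₀ : ∀ p, z₀ p ∈ Set.Icc (0 : ℝ) 1) (hS : ∀ p ∈ S, z₀ p = 1)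
    (p : ℤ × ZMod L₂) :
    Antitone fun l => winIter L₂ dl dr γ₁ γ₂ T ε S z₀ l p := by
  have mem := winIter_mem_Icc dl dr hγ₁ hγ₂ hT hε S hz₀
  refine antitone_nat_of_succ_le fun l => ?_
  by_cases hp : p ∈ S
  · induction l generalizing p with
    | zero => exact (mem 1 p).2.trans_eq (hS p hp).symm
    | succ l ih =>
      have step : ∀ q, winIter L₂ dl dr γ₁ γ₂ T ε S z₀ (l + 1) q
          ≤ winIter L₂ dl dr γ₁ γ₂ T ε S z₀ l q := by
        intro q
        by_cases hq : q ∈ S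
        · exact ih q hq
        · simp only [winIter_of_notMem dl dr γ₁ γ₂ T ε z₀ _ hq, le_refl]
      have key := updF_mono dl dr hγ₁ hγ₂ hT hε.1 (mem (l + 1)) (mem l) step p
      rw [winIter, winIter, winUpd, winUpd, if_pos hp, if_pos hp]
      exact key
  · simp only [winIter_of_notMem dl dr γ₁ γ₂ T ε z₀ _ hp, le_refl]

/-- Enlarging the window, within the region where the initial constellation is maximal,
decreases the windowed iterates. -/
theorem winIter_le_of_subset {L₂ γ₁ γ₂ : ℕ} (dl dr : ℕ) {T ε : ℝ} (hγ₁ : 1 ≤ γ₁)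
    (hγ₂ : 2 ≤ γ₂) (hT : T ∈ Set.Icc (0 : ℝ) 1) (hε : ε ∈ Set.Icc (0 : ℝ) 1)
    {S S' : Set (ℤ × ZMod L₂)} (hSS' : S' ⊆ S) {z₀ : ℤ × ZMod L₂ → ℝ}
    (hz₀ : ∀ p, z₀ p ∈ Set.Icc (0 : ℝ) 1) (hS : ∀ p ∈ S, z₀ p = 1) (l : ℕ)
    (p : ℤ × ZMod L₂) :
    winIter L₂ dl dr γ₁ γ₂ T ε S z₀ l p ≤ winIter L₂ dl dr γ₁ γ₂ T ε S' z₀ l p := by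
  have mem := winIter_mem_Icc dl dr hγ₁ hγ₂ hT hε S hz₀
  have mem' := winIter_mem_Icc dl dr hγ₁ hγ₂ hT hε S' hz₀
  induction l generalizing p with
  | zero => exact le_rfl
  | succ l ih =>
    by_cases hp' : p ∈ S'
    · rw [winIter, winIter, winUpd, winUpd, if_pos (hSS' hp'), if_pos hp']
      exact updF_mono dl dr hγ₁ hγ₂ hT hε.1 (mem l) (mem' l) ih p
    · rw [winIter_of_notMem dl dr γ₁ γ₂ T ε z₀ (l + 1) hp']
      by_cases hp : p ∈ S
      · exact (mem (l + 1) p).2.trans_eq (hS p hp).symm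
      · rw [winIter_of_notMem dl dr γ₁ γ₂ T ε z₀ (l + 1) hp]

theorem winConfig_mono {L₂ : ℕ} {W W' : ZMod L₂ → ℕ} (h : ∀ j, W' j ≤ W j)
    (t : ℤ × ZMod L₂) : winConfig L₂ W' t ⊆ winConfig L₂ W t := by
  rintro p ⟨r, hr, k, hk, rfl⟩
  exact ⟨r, hr, k, hk.trans_le (h _), rfl⟩

theorem worstInit_mem_Icc (L₂ : ℕ) {δ : ℝ} (hδ : δ ∈ Set.Icc (0 : ℝ) 1) (p : ℤ × ZMod L₂) :
    worstInit L₂ δ p ∈ Set.Icc (0 : ℝ) 1 := by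
  unfold worstInit
  split_ifs
  · exact hδ
  · exact ⟨zero_le_one, le_rfl⟩

theorem worstInit_eq_one_of_mem_winConfig {L₂ : ℕ} (δ : ℝ) (W : ZMod L₂ → ℕ) (j : ZMod L₂)
    {p : ℤ × ZMod L₂} (hp : p ∈ winConfig L₂ W (0, j)) : worstInit L₂ δ p = 1 := by
  obtain ⟨r, -, k, -, rfl⟩ := hp
  simp [worstInit]

/-- Lemma 3: if `W'_j ≤ W_j` for every `j`, then the worst-case
window BP thresholds satisfy `ε^worst_{δ,W'} ≤ ε^worst_{δ,W}`. -/
theorem stmt10 (dl dr L₂ γ₁ γ₂ : ℕ) (T δ : ℝ)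
    (hdl : 2 ≤ dl) (hdr : 2 ≤ dr) (hL₂ : 2 ≤ L₂)
    (hγ₁ : 1 ≤ γ₁) (hγ₂ : 2 ≤ γ₂) (hγ₂L : γ₂ ≤ L₂)
    (hT : T ∈ Set.Icc (0 : ℝ) 1) (hδ : δ ∈ Set.Icc (0 : ℝ) 1)
    (W W' : ZMod L₂ → ℕ) (hWW' : ∀ j, W' j ≤ W j) :
    epsWorst L₂ dl dr γ₁ γ₂ T δ W' ≤ epsWorst L₂ dl dr γ₁ γ₂ T δ W := by
  have init := worstInit_mem_Icc L₂ hδ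
  have hS := fun p => worstInit_eq_one_of_mem_winConfig δ W 0 (p := p)
  rw [epsWorst]
  rcases Set.eq_empty_or_nonempty {ε : ℝ | ε ∈ Set.Icc (0 : ℝ) 1 ∧ ∃ a : ℝ, a ≤ δ ∧
      Filter.Tendsto (fun l => worstQ L₂ dl dr γ₁ γ₂ T ε δ W' l ((0 : ℤ), (0 : ZMod L₂)))
        Filter.atTop (nhds a)} with he | hne
  · rw [he, Real.sSup_empty]
    exact Real.sSup_nonneg fun ε hε => hε.1.1
  · refine csSup_le_csSup ⟨1, fun ε hε => hε.1.2⟩ hne ?_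
    rintro ε ⟨hε, a, ha, hlim⟩
    refine ⟨hε, _, ?_, tendsto_atTop_ciInf
      (winIter_antitone dl dr hγ₁ hγ₂ hT hε init hS (0, 0)) ⟨0, ?_⟩⟩
    · refine (le_of_tendsto_of_tendsto' (tendsto_atTop_ciInf
        (winIter_antitone dl dr hγ₁ hγ₂ hT hε init hS (0, 0)) ⟨0, ?_⟩) hlim fun l =>
          winIter_le_of_subset dl dr hγ₁ hγ₂ hT hε (winConfig_mono hWW' (0, 0)) init hS l
            (0, 0)).trans ha
      rintro _ ⟨l, rfl⟩
      exact (winIter_mem_Icc dl dr hγ₁ hγ₂ hT hε _ init l _).1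
    · rintro _ ⟨l, rfl⟩
      exact (winIter_mem_Icc dl dr hγ₁ hγ₂ hT hε _ init l _).1
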